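/- Let Δ be a reduced crystallographic irreducible root system spanning a finite-dimensional real inner product space V, with base Π, positive system Δ⁺ and highest root θ, and normalize the inner product so that (θ|θ) = 2. Set ρ := (1/2) Σ_{α ∈ Δ⁺} α and h^∨ := (ρ|θ) + 1 (the dual Coxeter number). Then for all λ, η ∈ V, Σ_{α ∈ Δ} (λ|α)(η|α) = 2 h^∨ (λ|η). -/

import Mathlib

open scoped RealInnerProductSpace BigOperators

variable {V : Type*} [NormedAddCommGroup V] [InnerProductSpace ℝ V]

/-- The orthogonal reflection `s_α : x ↦ x − (2 (x|α)/(α|α)) α` in the hyperplane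
orthogonal to `α`, as a linear automorphism of `V`. -/
noncomputable def rootReflection (α : V) : V ≃ₗ[ℝ] V where
  toFun x := x - (2 * ⟪x, α⟫ / ⟪α, α⟫) • α
  invFun x := x - (2 * ⟪x, α⟫ / ⟪α, α⟫) • α
  map_add' x y := by
    simp only [inner_add_left]
    rw [show 2 * (⟪x, α⟫ + ⟪y, α⟫) / ⟪α, α⟫
        = 2 * ⟪x, α⟫ / ⟪α, α⟫ + 2 * ⟪y, α⟫ / ⟪α, α⟫ by ring, add_smul]
    abel
  map_smul' c x := by
    simp only [real_inner_smul_left, RingHom.id_apply, smul_sub, smul_smul]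
    rw [show 2 * (c * ⟪x, α⟫) / ⟪α, α⟫ = c * (2 * ⟪x, α⟫ / ⟪α, α⟫) by ring]
  left_inv x := by
    rcases eq_or_ne α 0 with h | h
    · simp [h]
    · have hα : ⟪α, α⟫ ≠ 0 := inner_self_ne_zero.mpr h
      simp only [inner_sub_left, real_inner_smul_left]
      rw [show 2 * (⟪x, α⟫ - 2 * ⟪x, α⟫ / ⟪α, α⟫ * ⟪α, α⟫) / ⟪α, α⟫
          = -(2 * ⟪x, α⟫ / ⟪α, α⟫) by field_simp; ring]
      module
  right_inv x := by
    rcases eq_or_ne α 0 with h | h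
    · simp [h]
    · have hα : ⟪α, α⟫ ≠ 0 := inner_self_ne_zero.mpr h
      simp only [inner_sub_left, real_inner_smul_left]
      rw [show 2 * (⟪x, α⟫ - 2 * ⟪x, α⟫ / ⟪α, α⟫ * ⟪α, α⟫) / ⟪α, α⟫
          = -(2 * ⟪x, α⟫ / ⟪α, α⟫) by field_simp; ring]
      module

/-- `Δ` is a reduced crystallographic root system in the real inner product space `V`. -/
structure IsRootSystem {V : Type*} [NormedAddCommGroup V] [InnerProductSpace ℝ V]
    (Δ : Finset V) : Prop where
  /-- `0 ∉ Δ`. -/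
  ne_zero : ∀ α ∈ Δ, α ≠ 0
  /-- `Δ` spans `V`. -/
  span_eq_top : Submodule.span ℝ (Δ : Set V) = ⊤
  /-- each reflection `s_α` maps `Δ` onto itself. -/
  reflect_mem : ∀ α ∈ Δ, ∀ β ∈ Δ, β - (2 * ⟪β, α⟫ / ⟪α, α⟫) • α ∈ Δ
  /-- crystallographic condition: `2(α|β)/(β|β) ∈ ℤ`. -/
  crystallographic : ∀ α ∈ Δ, ∀ β ∈ Δ, ∃ n : ℤ, 2 * ⟪α, β⟫ / ⟪β, β⟫ = (n : ℝ)
  /-- reduced: `ℝα ∩ Δ = {α, −α}`. -/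
  reduced : ∀ α ∈ Δ, ∀ t : ℝ, t • α ∈ Δ → t = 1 ∨ t = -1

/-- The Weyl group of `Δ`: the group of (orthogonal) transformations of `V` generated by
the reflections `s_α`, `α ∈ Δ`. -/
noncomputable def weylGroup (Δ : Finset V) : Subgroup (V ≃ₗ[ℝ] V) :=
  Subgroup.closure {g | ∃ α ∈ Δ, g = rootReflection α}

/-- `Δ` is irreducible: the only subspaces of `V` invariant under the Weyl group
are `{0}` and `V`. -/
def IsIrreducibleRS (Δ : Finset V) : Prop :=
  ∀ U : Submodule ℝ V, (∀ w ∈ weylGroup Δ, ∀ x ∈ U, w x ∈ U) → U = ⊥ ∨ U = ⊤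

/-- `b` is a base of `Δ`: a basis of `V` consisting of roots such that every root is an
integer combination of the base with coefficients all nonnegative or all nonpositive. -/
structure IsBase {V : Type*} [NormedAddCommGroup V] [InnerProductSpace ℝ V]
    (Δ : Finset V) {ι : Type*} [Fintype ι] (b : Module.Basis ι ℝ V) : Prop where
  mem : ∀ i, b i ∈ Δ
  int_coeff : ∀ α ∈ Δ, ∀ i, ∃ n : ℤ, b.repr α i = (n : ℝ)
  same_sign : ∀ α ∈ Δ, (∀ i, 0 ≤ b.repr α i) ∨ (∀ i, b.repr α i ≤ 0)

open Classical in
/-- The set `Δ⁺` of positive roots with respect to the base `b`. -/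
noncomputable def posRoots (Δ : Finset V) {ι : Type*} [Fintype ι] (b : Module.Basis ι ℝ V) :
    Finset V :=
  Δ.filter fun α => ∀ i, 0 ≤ b.repr α i

lemma IsRootSystem.neg_mem {Δ : Finset V} (hΔ : IsRootSystem Δ) {α : V} (hα : α ∈ Δ) :
    -α ∈ Δ := by
  have h := hΔ.reflect_mem α hα α hα
  have hne : ⟪α, α⟫ ≠ 0 := inner_self_ne_zero.mpr (hΔ.ne_zero α hα)
  rwa [mul_div_assoc, div_self hne, show α - ((2 : ℝ) * 1) • α = -α by module] at h

lemma rootReflection_apply (α x : V) :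
    rootReflection α x = x - (2 * ⟪x, α⟫ / ⟪α, α⟫) • α := rfl

lemma rootReflection_involutive (α x : V) : rootReflection α (rootReflection α x) = x :=
  (rootReflection α).left_inv x

lemma inner_rootReflection_left (α x y : V) :
    ⟪rootReflection α x, y⟫ = ⟪x, rootReflection α y⟫ := by
  simp only [rootReflection_apply, inner_sub_left, inner_sub_right, real_inner_smul_left,
    real_inner_smul_right, real_inner_comm α y]
  ring

/-- The operator `x ↦ ∑_{α ∈ Δ} (x|α) α`. -/
noncomputable def rootSumOperator (Δ : Finset V) : V →ₗ[ℝ] V where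
  toFun x := ∑ α ∈ Δ, ⟪x, α⟫ • α
  map_add' x y := by simp [inner_add_left, add_smul, Finset.sum_add_distrib]
  map_smul' c x := by simp [real_inner_smul_left, mul_smul, Finset.smul_sum]

lemma rootSumOperator_apply (Δ : Finset V) (x : V) :
    rootSumOperator Δ x = ∑ α ∈ Δ, ⟪x, α⟫ • α := rfl

lemma inner_rootSumOperator (Δ : Finset V) (x y : V) :
    ⟪rootSumOperator Δ x, y⟫ = ∑ α ∈ Δ, ⟪x, α⟫ * ⟪y, α⟫ := by
  rw [rootSumOperator_apply, sum_inner]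
  exact Finset.sum_congr rfl fun α _ => by rw [real_inner_smul_left, real_inner_comm y α]

lemma rootSumOperator_isSymmetric (Δ : Finset V) : (rootSumOperator Δ).IsSymmetric := by
  intro x y
  rw [← real_inner_comm x, inner_rootSumOperator, inner_rootSumOperator]
  exact Finset.sum_congr rfl fun _ _ => mul_comm _ _

lemma IsRootSystem.rootSumOperator_rootReflection {Δ : Finset V} (hΔ : IsRootSystem Δ)
    {α : V} (hα : α ∈ Δ) (x : V) :
    rootSumOperator Δ (rootReflection α x) = rootReflection α (rootSumOperator Δ x) := by
  simp only [rootSumOperator_apply, map_sum, map_smul]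
  refine Finset.sum_nbij' (rootReflection α) (rootReflection α)
    (fun β hβ => hΔ.reflect_mem α hα β hβ) (fun β hβ => hΔ.reflect_mem α hα β hβ)
    (fun β _ => rootReflection_involutive α β) (fun β _ => rootReflection_involutive α β) ?_
  intro β _
  rw [rootReflection_involutive, inner_rootReflection_left]

lemma IsRootSystem.rootSumOperator_weylGroup {Δ : Finset V} (hΔ : IsRootSystem Δ)
    {w : V ≃ₗ[ℝ] V} (hw : w ∈ weylGroup Δ) (x : V) :
    rootSumOperator Δ (w x) = w (rootSumOperator Δ x) := by
  induction hw using Subgroup.closure_induction generalizing x with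
  | mem g hg =>
    obtain ⟨α, hα, rfl⟩ := hg
    exact hΔ.rootSumOperator_rootReflection hα x
  | one => rfl
  | mul g h _ _ hg hh => simp only [LinearEquiv.mul_apply, hg, hh]
  | inv g _ hg =>
    apply g.injective
    rw [← hg]
    simp only [← LinearEquiv.mul_apply, mul_inv_cancel]
    rfl

/-- Schur's lemma for `rootSumOperator`. -/
lemma IsRootSystem.exists_rootSumOperator_eq_smul [FiniteDimensional ℝ V] [Nontrivial V]
    {Δ : Finset V} (hΔ : IsRootSystem Δ) (hirr : IsIrreducibleRS Δ) :
    ∃ c : ℝ, ∀ x, rootSumOperator Δ x = c • x := by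
  have heig := (rootSumOperator_isSymmetric Δ).hasEigenvalue_iSup_of_finiteDimensional
  set c := ⨆ x : { x : V // x ≠ 0 }, RCLike.re ⟪rootSumOperator Δ x, (x : V)⟫ / ‖(x : V)‖ ^ 2
  refine ⟨c, fun x => ?_⟩
  have htop := (hirr (Module.End.eigenspace (rootSumOperator Δ) c) ?_).resolve_left heig
  · exact Module.End.mem_eigenspace_iff.mp (htop ▸ Submodule.mem_top)
  · intro w hw y hy
    rw [Module.End.mem_eigenspace_iff] at hy ⊢
    rw [hΔ.rootSumOperator_weylGroup hw, hy, map_smul]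

section HighestRoot

variable {ι : Type*} {Δ : Finset V} {b : Module.Basis ι ℝ V} {θ : V}

lemma IsRootSystem.repr_highestRoot_nonneg (hΔ : IsRootSystem Δ) (hθΔ : θ ∈ Δ)
    (hθ : ∀ α ∈ Δ, ∀ i, b.repr α i ≤ b.repr θ i) (i : ι) : 0 ≤ b.repr θ i := by
  have h := hθ _ (hΔ.neg_mem hθΔ) i
  rw [map_neg, Finsupp.neg_apply] at h
  linarith

lemma IsRootSystem.exists_inner_eq_intCast (hΔ : IsRootSystem Δ) (hθΔ : θ ∈ Δ)
    (hnorm : ⟪θ, θ⟫ = 2) {α : V} (hα : α ∈ Δ) :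
    ∃ n : ℤ, ⟪α, θ⟫ = n ∧ α - (n : ℝ) • θ ∈ Δ := by
  obtain ⟨n, hn⟩ := hΔ.crystallographic α hα θ hθΔ
  have hmem := hΔ.reflect_mem θ hθΔ α hα
  rw [hn] at hmem
  exact ⟨n, by rw [← hn, hnorm]; ring, hmem⟩

lemma IsRootSystem.inner_highestRoot_le_one (hΔ : IsRootSystem Δ) (hθΔ : θ ∈ Δ)
    (hθ : ∀ α ∈ Δ, ∀ i, b.repr α i ≤ b.repr θ i) (hnorm : ⟪θ, θ⟫ = 2)
    {α : V} (hα : α ∈ Δ) (hne : α ≠ θ) : ⟪α, θ⟫ ≤ 1 := by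
  obtain ⟨n, hn, hmem⟩ := hΔ.exists_inner_eq_intCast hθΔ hnorm hα
  rw [hn]
  by_contra! hlt
  have hn2 : (2 : ℝ) ≤ n := by
    have : 1 < n := by exact_mod_cast hlt
    exact_mod_cast this
  refine hne (b.ext_elem fun i => ?_)
  have h := hθ _ (hΔ.neg_mem hmem) i
  simp only [map_neg, map_sub, map_smul, Finsupp.neg_apply, Finsupp.sub_apply,
    Finsupp.smul_apply, smul_eq_mul] at h
  nlinarith [hθ α hα i, hΔ.repr_highestRoot_nonneg hθΔ hθ i]

variable [Fintype ι]

lemma repr_le_of_sub_eq_sum {α : V} (h : ∃ c : ι → ℕ, θ - α = ∑ i, (c i : ℝ) • b i) (i : ι) :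
    b.repr α i ≤ b.repr θ i := by
  obtain ⟨c, hc⟩ := h
  have h := congrArg (fun v => b.repr v i) hc
  simp only [b.repr_sum_self, map_sub, Finsupp.sub_apply] at h
  linarith [(c i).cast_nonneg (α := ℝ)]

lemma IsRootSystem.inner_highestRoot_nonneg (hΔ : IsRootSystem Δ) (hθΔ : θ ∈ Δ)
    (hθ : ∀ α ∈ Δ, ∀ i, b.repr α i ≤ b.repr θ i) (hnorm : ⟪θ, θ⟫ = 2)
    {α : V} (hα : α ∈ posRoots Δ b) : 0 ≤ ⟪α, θ⟫ := by
  obtain ⟨hαΔ, hpos⟩ := Finset.mem_filter.mp hα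
  obtain ⟨n, hn, hmem⟩ := hΔ.exists_inner_eq_intCast hθΔ hnorm hαΔ
  rw [hn]
  by_contra! hlt
  have hn1 : (n : ℝ) ≤ -1 := by
    have : n < 0 := by exact_mod_cast hlt
    exact_mod_cast Int.le_sub_one_of_lt this
  refine hΔ.ne_zero α hαΔ (b.ext_elem fun i => ?_)
  have h := hθ _ hmem i
  simp only [map_sub, map_smul, Finsupp.sub_apply, Finsupp.smul_apply, smul_eq_mul] at h
  simp only [map_zero, Finsupp.zero_apply]
  nlinarith [hpos i, hΔ.repr_highestRoot_nonneg hθΔ hθ i]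

lemma IsRootSystem.inner_highestRoot_sq (hΔ : IsRootSystem Δ) (hθΔ : θ ∈ Δ)
    (hθ : ∀ α ∈ Δ, ∀ i, b.repr α i ≤ b.repr θ i) (hnorm : ⟪θ, θ⟫ = 2)
    {α : V} (hα : α ∈ posRoots Δ b) (hne : α ≠ θ) : ⟪α, θ⟫ ^ 2 = ⟪α, θ⟫ := by
  have hαΔ := (Finset.mem_filter.mp hα).1
  have h0 := hΔ.inner_highestRoot_nonneg hθΔ hθ hnorm hα
  have h1 := hΔ.inner_highestRoot_le_one hθΔ hθ hnorm hαΔ hne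
  obtain ⟨n, hn, -⟩ := hΔ.exists_inner_eq_intCast hθΔ hnorm hαΔ
  rw [hn] at h0 h1 ⊢
  have h0' : 0 ≤ n := by exact_mod_cast h0
  have h1' : n ≤ 1 := by exact_mod_cast h1
  obtain rfl | rfl : n = 0 ∨ n = 1 := by omega
  all_goals norm_num

/-- A sum over all roots of an even function is twice its sum over the positive roots. -/
lemma IsRootSystem.sum_eq_two_mul_sum_posRoots (hΔ : IsRootSystem Δ) (hb : IsBase Δ b)
    (f : V → ℝ) (hf : ∀ α, f (-α) = f α) :
    ∑ α ∈ Δ, f α = 2 * ∑ α ∈ posRoots Δ b, f α := by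
  classical
  have hneg : ∑ α ∈ Δ with ¬ ∀ i, 0 ≤ b.repr α i, f α = ∑ α ∈ posRoots Δ b, f α := by
    refine Finset.sum_nbij' (fun α => -α) (fun α => -α) ?_ ?_ (fun α _ => neg_neg α)
      (fun α _ => neg_neg α) (fun α _ => (hf α).symm)
    · intro α hα
      obtain ⟨hαΔ, hα⟩ := Finset.mem_filter.mp hα
      refine Finset.mem_filter.mpr ⟨hΔ.neg_mem hαΔ, fun i => ?_⟩
      simpa using (hb.same_sign α hαΔ).resolve_left hα i
    · intro α hα
      obtain ⟨hαΔ, hα⟩ := Finset.mem_filter.mp hα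
      refine Finset.mem_filter.mpr ⟨hΔ.neg_mem hαΔ, fun h => hΔ.ne_zero α hαΔ ?_⟩
      refine b.ext_elem fun i => ?_
      have hi := h i
      rw [map_neg, Finsupp.neg_apply] at hi
      rw [map_zero, Finsupp.zero_apply]
      linarith [hα i]
  have hpos : ∑ α ∈ Δ with ∀ i, 0 ≤ b.repr α i, f α = ∑ α ∈ posRoots Δ b, f α :=
    Finset.sum_congr (by ext; simp [posRoots]) fun _ _ => rfl
  rw [← Finset.sum_filter_add_sum_filter_not Δ (fun α => ∀ i, 0 ≤ b.repr α i), hneg, hpos]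
  ring

lemma IsRootSystem.sum_inner_highestRoot_sq (hΔ : IsRootSystem Δ) (hθΔ : θ ∈ Δ)
    (hθ : ∀ α ∈ Δ, ∀ i, b.repr α i ≤ b.repr θ i) (hnorm : ⟪θ, θ⟫ = 2) :
    ∑ α ∈ posRoots Δ b, ⟪α, θ⟫ ^ 2 = ∑ α ∈ posRoots Δ b, ⟪α, θ⟫ + 2 := by
  classical
  have hθpos : θ ∈ posRoots Δ b :=
    Finset.mem_filter.mpr ⟨hθΔ, hΔ.repr_highestRoot_nonneg hθΔ hθ⟩
  have hrest : ∑ α ∈ (posRoots Δ b).erase θ, ⟪α, θ⟫ ^ 2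
      = ∑ α ∈ (posRoots Δ b).erase θ, ⟪α, θ⟫ :=
    Finset.sum_congr rfl fun α hα => hΔ.inner_highestRoot_sq hθΔ hθ hnorm
      (Finset.mem_of_mem_erase hα) (Finset.ne_of_mem_erase hα)
  rw [← Finset.add_sum_erase _ _ hθpos, ← Finset.add_sum_erase _ _ hθpos, hrest, hnorm]
  ring

end HighestRoot

/-- **The strange formula variant (cf. Kac, Cor. 8.7).** For an irreducible reduced
crystallographic root system `Δ` with highest root `θ` normalized by `(θ|θ) = 2`,
with `ρ = (1/2) Σ_{α ∈ Δ⁺} α` and dual Coxeter number `h^∨ = (ρ|θ) + 1`, one has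
`Σ_{α ∈ Δ} (λ|α)(η|α) = 2 h^∨ (λ|η)` for all `λ, η ∈ V`. -/
theorem sum_inner_mul_inner_eq_dual_coxeter {V : Type*} [NormedAddCommGroup V]
    [InnerProductSpace ℝ V] [FiniteDimensional ℝ V] {ι : Type*} [Fintype ι]
    (Δ : Finset V) (hΔ : IsRootSystem Δ) (hirr : IsIrreducibleRS Δ)
    (b : Module.Basis ι ℝ V) (hb : IsBase Δ b)
    (θ : V) (hθΔ : θ ∈ Δ)
    (hθ : ∀ α ∈ Δ, ∃ c : ι → ℕ, θ - α = ∑ i, (c i : ℝ) • b i)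
    (hnorm : ⟪θ, θ⟫ = 2) :
    ∀ l η : V, ∑ α ∈ Δ, ⟪l, α⟫ * ⟪η, α⟫ =
      2 * (⟪(1 / 2 : ℝ) • ∑ α ∈ posRoots Δ b, α, θ⟫ + 1) * ⟪l, η⟫ := by
  intro l η
  have : Nontrivial V := ⟨θ, 0, hΔ.ne_zero θ hθΔ⟩
  obtain ⟨c, hc⟩ := hΔ.exists_rootSumOperator_eq_smul hirr
  have hsum (x y : V) : ∑ α ∈ Δ, ⟪x, α⟫ * ⟪y, α⟫ = c * ⟪x, y⟫ := by
    rw [← inner_rootSumOperator, hc, real_inner_smul_left]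
  have hθθ : ∑ α ∈ Δ, ⟪α, θ⟫ ^ 2 = c * 2 := by
    rw [← hnorm, ← hsum]
    exact Finset.sum_congr rfl fun α _ => by rw [real_inner_comm, sq]
  rw [hΔ.sum_eq_two_mul_sum_posRoots hb _ fun α => by rw [inner_neg_left, neg_sq],
    hΔ.sum_inner_highestRoot_sq hθΔ (fun α hα => repr_le_of_sub_eq_sum (hθ α hα)) hnorm] at hθθ
  rw [hsum, real_inner_smul_left, sum_inner]
  congr 1
  linarith
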